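/- Let (τ_m)_{m≥2} be a family of polynomials in ℝ[x₁,x₂,x₃] such that each τ_m is homogeneous of degree m and lies in the ℝ-subalgebra generated by e₂, e₃, e₄. Suppose τ₂ = a₂·e₂, τ₃ = 0, τ₄ = a₄·e₄ + b₄·e₂², and τ₆ = a₆·e₃² + b₆·e₂·e₄ + c₆·e₂³, where none of a₂, a₄, a₆ is zero. Then for any polynomial f ∈ ℝ[x₁,x₂,x₃], one has τ_m(∂)f = 0 for all m ≥ 2 if and only if e₂(∂)f = e₄(∂)f = e₆(∂)f = 0, where e₆ = e₃². -/

import Mathlib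

open MvPolynomial

noncomputable def dop (φ : MvPolynomial (Fin 3) ℝ) :
    MvPolynomial (Fin 3) ℝ →ₗ[ℝ] MvPolynomial (Fin 3) ℝ :=
  φ.support.sum fun s => φ.coeff s •
    (((pderiv (0 : Fin 3)).toLinearMap ^ s 0) *
     ((pderiv (1 : Fin 3)).toLinearMap ^ s 1) *
     ((pderiv (2 : Fin 3)).toLinearMap ^ s 2))

noncomputable def e2 : MvPolynomial (Fin 3) ℝ := X 0 ^ 2 + X 1 ^ 2 + X 2 ^ 2
noncomputable def e3 : MvPolynomial (Fin 3) ℝ := X 0 * X 1 * X 2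
noncomputable def e4 : MvPolynomial (Fin 3) ℝ :=
  X 1 ^ 2 * X 2 ^ 2 + X 2 ^ 2 * X 0 ^ 2 + X 0 ^ 2 * X 1 ^ 2
noncomputable def e6 : MvPolynomial (Fin 3) ℝ := e3 ^ 2

lemma pderiv_commute {R σ : Type*} [CommRing R] (i j : σ) :
    Commute (pderiv (R := R) i).toLinearMap (pderiv (R := R) j).toLinearMap := by
  classical
  have h : ⁅pderiv (R := R) i, pderiv (R := R) j⁆ = 0 := by
    refine MvPolynomial.derivation_ext fun k => ?_
    simp [Derivation.commutator_apply, pderiv_X, Pi.single_apply, apply_ite]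
  refine LinearMap.ext fun p => sub_eq_zero.mp ?_
  simpa [Derivation.commutator_apply] using congr($h p)

/-- The monomial differential operators, as a monoid homomorphism from exponents. -/
noncomputable def monomialOp :
    Multiplicative (Fin 3 →₀ ℕ) →* Module.End ℝ (MvPolynomial (Fin 3) ℝ) where
  toFun s := ((pderiv (0 : Fin 3)).toLinearMap ^ s.toAdd 0) *
    ((pderiv (1 : Fin 3)).toLinearMap ^ s.toAdd 1) *
    ((pderiv (2 : Fin 3)).toLinearMap ^ s.toAdd 2)
  map_one' := by simp
  map_mul' s t := by
    have h (i j : Fin 3) (m n : ℕ) :=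
      (pderiv_commute (R := ℝ) i j).pow_pow m n
    simp only [toAdd_mul, Finsupp.add_apply, pow_add]
    rw [(h 0 1 _ _).mul_mul_mul_comm, ((h 2 0 _ _).mul_right (h 2 1 _ _)).symm.mul_mul_mul_comm]

/-- Substituting partial derivatives for the variables, as an algebra homomorphism. -/
noncomputable def dopHom :
    MvPolynomial (Fin 3) ℝ →ₐ[ℝ] Module.End ℝ (MvPolynomial (Fin 3) ℝ) :=
  AddMonoidAlgebra.lift ℝ _ _ monomialOp

lemma dopHom_apply (φ : MvPolynomial (Fin 3) ℝ) : dopHom φ = dop φ :=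
  AddMonoidAlgebra.lift_apply monomialOp φ

/-- The polynomials whose differential operators annihilate `f`. -/
noncomputable def annihilatorIdeal (f : MvPolynomial (Fin 3) ℝ) :
    Ideal (MvPolynomial (Fin 3) ℝ) where
  carrier := {φ | dop φ f = 0}
  zero_mem' := by simp [← dopHom_apply]
  add_mem' {φ ψ} hφ hψ := by
    simp_all [← dopHom_apply]
  smul_mem' φ ψ hψ := by
    simp_all [← dopHom_apply]

lemma mem_annihilatorIdeal {f φ : MvPolynomial (Fin 3) ℝ} :
    φ ∈ annihilatorIdeal f ↔ dop φ f = 0 := Iff.rfl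

lemma isHomogeneous_e2 : e2.IsHomogeneous 2 :=
  ((isHomogeneous_X_pow _ _).add (isHomogeneous_X_pow _ _)).add (isHomogeneous_X_pow _ _)

lemma isHomogeneous_e3 : e3.IsHomogeneous 3 :=
  ((isHomogeneous_X ℝ _).mul (isHomogeneous_X ℝ _)).mul (isHomogeneous_X ℝ _)

lemma isHomogeneous_e4 : e4.IsHomogeneous 4 :=
  have h (i j : Fin 3) : (X i ^ 2 * X j ^ 2 : MvPolynomial (Fin 3) ℝ).IsHomogeneous 4 :=
    (isHomogeneous_X_pow i 2).mul (isHomogeneous_X_pow j 2)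
  ((h 1 2).add (h 2 0)).add (h 0 1)

lemma isHomogeneous_e6 : e6.IsHomogeneous 6 := isHomogeneous_e3.pow 2

/-- Modulo `e2`, `e4`, `e6`, the algebra generated by `e2`, `e3`, `e4` is spanned by `1`, `e3`. -/
lemma exists_sub_mem_span_of_mem_adjoin {φ : MvPolynomial (Fin 3) ℝ}
    (h : φ ∈ Algebra.adjoin ℝ ({e2, e3, e4} : Set (MvPolynomial (Fin 3) ℝ))) :
    ∃ c d : ℝ, φ - (C c + C d * e3) ∈ Ideal.span {e2, e4, e6} := by
  have hmem {ψ} (hψ : ψ ∈ ({e2, e4, e6} : Set (MvPolynomial (Fin 3) ℝ))) :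
      ψ ∈ Ideal.span {e2, e4, e6} := Ideal.subset_span hψ
  induction h using Algebra.adjoin_induction with
  | mem x hx =>
    rcases hx with rfl | rfl | rfl
    · exact ⟨0, 0, by simpa using hmem (by simp)⟩
    · exact ⟨0, 1, by simp⟩
    · exact ⟨0, 0, by simpa using hmem (by simp)⟩
  | algebraMap r => exact ⟨r, 0, by simp [algebraMap_eq]⟩
  | add x y _ _ hx hy =>
    obtain ⟨c, d, h⟩ := hx
    obtain ⟨c', d', h'⟩ := hy
    refine ⟨c + c', d + d', ?_⟩
    convert add_mem h h' using 1
    simp only [C_add]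
    ring
  | mul x y _ _ hx hy =>
    obtain ⟨c, d, h⟩ := hx
    obtain ⟨c', d', h'⟩ := hy
    refine ⟨c * c', c * d' + d * c', ?_⟩
    have h6 : e6 ∈ Ideal.span {e2, e4, e6} := hmem (by simp)
    convert add_mem (add_mem (Ideal.mul_mem_left _ y h)
      (Ideal.mul_mem_left _ (C c + C d * e3) h')) (Ideal.mul_mem_left _ (C d * C d') h6) using 1
    simp only [C_add, C_mul, e6]
    ring

lemma mem_span_of_mem_adjoin_of_isHomogeneous {φ : MvPolynomial (Fin 3) ℝ} {m : ℕ}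
    (h : φ ∈ Algebra.adjoin ℝ ({e2, e3, e4} : Set (MvPolynomial (Fin 3) ℝ)))
    (hφ : φ.IsHomogeneous m) (hm0 : m ≠ 0) (hm3 : m ≠ 3) :
    φ ∈ Ideal.span {e2, e4, e6} := by
  let := gradedAlgebra (σ := Fin 3) (R := ℝ)
  obtain ⟨c, d, hcd⟩ := exists_sub_mem_span_of_mem_adjoin h
  have hI : (Ideal.span {e2, e4, e6}).IsHomogeneous (homogeneousSubmodule (Fin 3) ℝ) := by
    refine Ideal.homogeneous_span _ _ ?_
    rintro x (rfl | rfl | rfl)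
    exacts [⟨2, isHomogeneous_e2⟩, ⟨4, isHomogeneous_e4⟩, ⟨6, isHomogeneous_e6⟩]
  have := homogeneousComponent_mem_of_mem hI hcd m
  simpa [homogeneousComponent_of_mem hφ, homogeneousComponent_C_mul,
    homogeneousComponent_of_mem isHomogeneous_e3,
    homogeneousComponent_of_mem (isHomogeneous_C (Fin 3) c), hm0, hm3] using this

theorem reduction_to_B3_harmonics
    (τ : ℕ → MvPolynomial (Fin 3) ℝ)
    (hhom : ∀ m, 2 ≤ m → (τ m).IsHomogeneous m)
    (hadj : ∀ m, 2 ≤ m →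
      τ m ∈ Algebra.adjoin ℝ ({e2, e3, e4} : Set (MvPolynomial (Fin 3) ℝ)))
    (a₂ a₄ b₄ a₆ b₆ c₆ : ℝ) (ha₂ : a₂ ≠ 0) (ha₄ : a₄ ≠ 0) (ha₆ : a₆ ≠ 0)
    (hτ₂ : τ 2 = C a₂ * e2)
    (hτ₃ : τ 3 = 0)
    (hτ₄ : τ 4 = C a₄ * e4 + C b₄ * e2 ^ 2)
    (hτ₆ : τ 6 = C a₆ * e3 ^ 2 + C b₆ * e2 * e4 + C c₆ * e2 ^ 3)
    (f : MvPolynomial (Fin 3) ℝ) :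
    (∀ m, 2 ≤ m → dop (τ m) f = 0) ↔
      (dop e2 f = 0 ∧ dop e4 f = 0 ∧ dop e6 f = 0) := by
  simp only [← mem_annihilatorIdeal]
  set I := annihilatorIdeal f
  have mem_of_C_mul {a : ℝ} {φ : MvPolynomial (Fin 3) ℝ} (ha : a ≠ 0) (h : C a * φ ∈ I) :
      φ ∈ I := by
    simpa [← mul_assoc, ← C_mul, ha] using I.mul_mem_left (C a⁻¹) h
  constructor
  · intro h
    have he2 : e2 ∈ I := mem_of_C_mul ha₂ (hτ₂ ▸ h 2 le_rfl)
    have he4 : e4 ∈ I := mem_of_C_mul ha₄ <| by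
      have h4 := h 4 (by norm_num)
      rw [hτ₄] at h4
      exact (I.add_mem_iff_left (I.mul_mem_left _ (I.pow_mem_of_mem he2 2 two_pos))).mp h4
    have he6 : e6 ∈ I := mem_of_C_mul ha₆ <| by
      have h6 := h 6 (by norm_num)
      rw [hτ₆, add_assoc] at h6
      exact (I.add_mem_iff_left (I.add_mem (I.mul_mem_left _ he4)
        (I.mul_mem_left _ (I.pow_mem_of_mem he2 3 three_pos)))).mp h6
    exact ⟨he2, he4, he6⟩
  · rintro ⟨he2, he4, he6⟩ m hm
    by_cases hm3 : m = 3
    · simp [hm3, hτ₃]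
    · refine Ideal.span_le.mpr ?_
        (mem_span_of_mem_adjoin_of_isHomogeneous (hadj m hm) (hhom m hm) (by lia) hm3)
      rintro x (rfl | rfl | rfl)
      exacts [he2, he4, he6]
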